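/- For every slot k ∈ S∖{1} and every (i,t) ∈ A, the lifted inequality x_{2n−2,i,t} + x_{k,i,t} + Σ_{j ∈ V∖{t}} x_{k,t,j} + x_{k−1,i,t} − 1 ≤ y_{t,i,t} is facet-defining for Ptt(n). -/

import Mathlib

open Finset

attribute [local instance] Classical.propDecidable

namespace TTP

/-- `(k,i,j)` is a valid match index: slot `k ∈ S = {1,…,2n-2}`, home venue `i` and
away team `j` are distinct elements of `V = {1,…,n}`. -/
def IsMatch (n : ℕ) (m : ℕ × ℕ × ℕ) : Prop :=
  1 ≤ m.1 ∧ m.1 ≤ 2 * n - 2 ∧ 1 ≤ m.2.1 ∧ m.2.1 ≤ n ∧ 1 ≤ m.2.2 ∧ m.2.2 ≤ n ∧ m.2.1 ≠ m.2.2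

/-- `(t,i,j)` is a valid travel index: `t ∈ V` and `(i,j) ∈ A`. -/
def IsTravelIdx (n : ℕ) (p : ℕ × ℕ × ℕ) : Prop :=
  1 ≤ p.1 ∧ p.1 ≤ n ∧ 1 ≤ p.2.1 ∧ p.2.1 ≤ n ∧ 1 ≤ p.2.2 ∧ p.2.2 ≤ n ∧ p.2.1 ≠ p.2.2

/-- A (double round-robin) tournament: a set of matches such that in every slot every team
plays exactly once, and every ordered pair of distinct teams meets exactly once. -/
structure IsTournament (n : ℕ) (T : Set (ℕ × ℕ × ℕ)) : Prop where
  subset : ∀ m ∈ T, IsMatch n m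
  slot_team : ∀ k, 1 ≤ k → k ≤ 2 * n - 2 → ∀ t, 1 ≤ t → t ≤ n →
      ∃! m : ℕ × ℕ × ℕ, m ∈ T ∧ m.1 = k ∧ (t = m.2.1 ∨ t = m.2.2)
  pair : ∀ i j, 1 ≤ i → i ≤ n → 1 ≤ j → j ≤ n → i ≠ j → ∃! k : ℕ, (k, i, j) ∈ T

/-- The venue of team `t` in slot `k`: the home venue of the (unique) match of `t` in
slot `k`, and `t` itself if `t` has no match in slot `k` (in particular in the artificial
slots `0` and `2n-1`). -/
noncomputable def venue (T : Set (ℕ × ℕ × ℕ)) (t k : ℕ) : ℕ :=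
  if h : ∃ i, ∃ j, (k, i, j) ∈ T ∧ (t = i ∨ t = j) then h.choose else t

/-- The travel vector `ψ(T)`: `travel n T (t,i,j) = 1` iff for some `0 ≤ k ≤ 2n-2` team `t`
has venue `i` in slot `k` and venue `j` in slot `k+1`. -/
noncomputable def travel (n : ℕ) (T : Set (ℕ × ℕ × ℕ)) (p : ℕ × ℕ × ℕ) : ℝ :=
  if ∃ k, k ≤ 2 * n - 2 ∧ venue T p.1 k = p.2.1 ∧ venue T p.1 (k + 1) = p.2.2 then 1 else 0

/-- The play vector `χ(T)`: characteristic vector of `T`. -/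
noncomputable def play (T : Set (ℕ × ℕ × ℕ)) (m : ℕ × ℕ × ℕ) : ℝ :=
  if m ∈ T then 1 else 0

/-- The ambient space `ℝ^M × ℝ^{V×A}`. -/
abbrev Pt (n : ℕ) :=
  ({m : ℕ × ℕ × ℕ // IsMatch n m} → ℝ) × ({p : ℕ × ℕ × ℕ // IsTravelIdx n p} → ℝ)

/-- The play coordinate `x_{k,i,j}` of a point (0 at invalid indices). -/
noncomputable def xval {n : ℕ} (z : Pt n) (k i j : ℕ) : ℝ :=
  if h : IsMatch n (k, i, j) then z.1 ⟨(k, i, j), h⟩ else 0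

/-- The travel coordinate `y_{t,i,j}` of a point (0 at invalid indices). -/
noncomputable def yval {n : ℕ} (z : Pt n) (t i j : ℕ) : ℝ :=
  if h : IsTravelIdx n (t, i, j) then z.2 ⟨(t, i, j), h⟩ else 0

/-- The unconstrained traveling tournament polytope `Ptt(n)`:
the convex hull of all pairs `(χ(T), y)` with `T` a tournament and `y ∈ {0,1}^{V×A}`,
`y ≥ ψ(T)` componentwise. -/
def Ptt (n : ℕ) : Set (Pt n) :=
  convexHull ℝ { z : Pt n | ∃ T : Set (ℕ × ℕ × ℕ), IsTournament n T ∧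
    (∀ m : {m : ℕ × ℕ × ℕ // IsMatch n m}, z.1 m = play T m.1) ∧
    (∀ p : {p : ℕ × ℕ × ℕ // IsTravelIdx n p}, z.2 p = 0 ∨ z.2 p = 1) ∧
    (∀ p : {p : ℕ × ℕ × ℕ // IsTravelIdx n p}, travel n T p.1 ≤ z.2 p) }

/-- Dimension of the affine hull of a set. -/
noncomputable def adim {n : ℕ} (s : Set (Pt n)) : ℕ :=
  Module.finrank ℝ (affineSpan ℝ s).direction

/-- A valid inequality `f z ≤ γ` is facet-defining for `Ptt(n)`:
it holds on `Ptt(n)` and its face has dimension `dim Ptt(n) - 1`. -/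
def IsFacetLE {n : ℕ} (f : Pt n → ℝ) (γ : ℝ) : Prop :=
  (∀ z ∈ Ptt n, f z ≤ γ) ∧ adim {z ∈ Ptt n | f z = γ} + 1 = adim (Ptt n)

/-- A valid inequality `f z ≥ γ` is facet-defining for `Ptt(n)`:
it holds on `Ptt(n)` and its face has dimension `dim Ptt(n) - 1`. -/
def IsFacetGE {n : ℕ} (f : Pt n → ℝ) (γ : ℝ) : Prop :=
  (∀ z ∈ Ptt n, γ ≤ f z) ∧ adim {z ∈ Ptt n | f z = γ} + 1 = adim (Ptt n)

/-- A slot assignment: `σ i j` is the slot of the match between `i` and `j` at venue `i`, and the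
`2n-2` matches of each team are assigned to distinct slots. -/
structure IsSched (n : ℕ) (σ : ℕ → ℕ → ℕ) : Prop where
  mem : ∀ i ∈ Icc 1 n, ∀ j ∈ Icc 1 n, i ≠ j → σ i j ∈ Icc 1 (2 * n - 2)
  home : ∀ t ∈ Icc 1 n, ∀ j ∈ Icc 1 n, ∀ j' ∈ Icc 1 n, t ≠ j → t ≠ j' → σ t j = σ t j' → j = j'
  away : ∀ t ∈ Icc 1 n, ∀ j ∈ Icc 1 n, ∀ j' ∈ Icc 1 n, t ≠ j → t ≠ j' → σ j t = σ j' t → j = j'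
  disj : ∀ t ∈ Icc 1 n, ∀ j ∈ Icc 1 n, ∀ j' ∈ Icc 1 n, t ≠ j → t ≠ j' → σ t j ≠ σ j' t

/-- The set of matches of a slot assignment. -/
def matchSet (n : ℕ) (σ : ℕ → ℕ → ℕ) : Set (ℕ × ℕ × ℕ) :=
  {m | m.2.1 ∈ Icc 1 n ∧ m.2.2 ∈ Icc 1 n ∧ m.2.1 ≠ m.2.2 ∧ σ m.2.1 m.2.2 = m.1}

theorem mem_matchSet {n : ℕ} {σ : ℕ → ℕ → ℕ} {k i j : ℕ} :
    (k, i, j) ∈ matchSet n σ ↔ i ∈ Icc 1 n ∧ j ∈ Icc 1 n ∧ i ≠ j ∧ σ i j = k := Iff.rfl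

/-- Every team plays in every slot. -/
theorem IsSched.exists_opponent {n : ℕ} {σ : ℕ → ℕ → ℕ} (h : IsSched n σ) {t k : ℕ}
    (ht : t ∈ Icc 1 n) (hk : k ∈ Icc 1 (2 * n - 2)) :
    ∃ j ∈ Icc 1 n, t ≠ j ∧ (σ t j = k ∨ σ j t = k) := by
  have hA : Set.InjOn (σ t) ((Icc 1 n).erase t : Finset ℕ) := by
    intro j hj j' hj' e
    simp only [coe_erase, Set.mem_sdiff, mem_coe, Set.mem_singleton_iff] at hj hj'
    exact h.home t ht j hj.1 j' hj'.1 (Ne.symm hj.2) (Ne.symm hj'.2) e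
  have hB : Set.InjOn (fun j => σ j t) ((Icc 1 n).erase t : Finset ℕ) := by
    intro j hj j' hj' e
    simp only [coe_erase, Set.mem_sdiff, mem_coe, Set.mem_singleton_iff] at hj hj'
    exact h.away t ht j hj.1 j' hj'.1 (Ne.symm hj.2) (Ne.symm hj'.2) e
  have hd : Disjoint (((Icc 1 n).erase t).image (σ t))
      (((Icc 1 n).erase t).image (fun j => σ j t)) := by
    rw [Finset.disjoint_left]
    intro s hs hs'
    simp only [mem_image, mem_erase] at hs hs'
    obtain ⟨j, ⟨hj, hjn⟩, e⟩ := hs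
    obtain ⟨j', ⟨hj', hjn'⟩, e'⟩ := hs'
    exact h.disj t ht j hjn j' hjn' (Ne.symm hj) (Ne.symm hj') (e.trans e'.symm)
  have hsub : ((Icc 1 n).erase t).image (σ t) ∪ ((Icc 1 n).erase t).image (fun j => σ j t) ⊆
      Icc 1 (2 * n - 2) := by
    intro s hs
    simp only [mem_union, mem_image, mem_erase] at hs
    rcases hs with ⟨j, ⟨hj, hjn⟩, rfl⟩ | ⟨j, ⟨hj, hjn⟩, rfl⟩
    · exact h.mem t ht j hjn (Ne.symm hj)
    · exact h.mem j hjn t ht hj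
  have heq := Finset.eq_of_subset_of_card_le hsub (by
    rw [card_union_of_disjoint hd, card_image_of_injOn hA, card_image_of_injOn hB,
      card_erase_of_mem ht]
    simp only [Nat.card_Icc]
    omega)
  rw [← heq] at hk
  simp only [mem_union, mem_image, mem_erase] at hk
  rcases hk with ⟨j, ⟨hj, hjn⟩, e⟩ | ⟨j, ⟨hj, hjn⟩, e⟩
  · exact ⟨j, hjn, Ne.symm hj, Or.inl e⟩
  · exact ⟨j, hjn, Ne.symm hj, Or.inr e⟩

theorem IsSched.isTournament {n : ℕ} {σ : ℕ → ℕ → ℕ} (h : IsSched n σ) :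
    IsTournament n (matchSet n σ) where
  subset := by
    rintro ⟨k, i, j⟩ hm
    obtain ⟨hi, hj, hij, rfl⟩ := mem_matchSet.1 hm
    have := h.mem i hi j hj hij
    simp only [mem_Icc] at hi hj this
    exact ⟨this.1, this.2, hi.1, hi.2, hj.1, hj.2, hij⟩
  slot_team := by
    intro k hk1 hk2 t ht1 ht2
    have ht : t ∈ Icc 1 n := mem_Icc.2 ⟨ht1, ht2⟩
    obtain ⟨j, hj, htj, e⟩ := h.exists_opponent ht (mem_Icc.2 ⟨hk1, hk2⟩)
    rcases e with e | e
    · refine ⟨(k, t, j), ⟨⟨ht, hj, htj, e⟩, rfl, Or.inl rfl⟩, ?_⟩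
      rintro ⟨k', a, b⟩ ⟨⟨ha, hb, hab, e'⟩, rfl, hc⟩
      simp only at ha hb hab e' hc
      rcases hc with rfl | rfl
      · rw [h.home t ht j hj b hb htj hab (e.trans e'.symm)]
      · exact absurd (e.trans e'.symm) (h.disj t ht j hj a ha htj (Ne.symm hab))
    · refine ⟨(k, j, t), ⟨⟨hj, ht, Ne.symm htj, e⟩, rfl, Or.inr rfl⟩, ?_⟩
      rintro ⟨k', a, b⟩ ⟨⟨ha, hb, hab, e'⟩, rfl, hc⟩
      simp only at ha hb hab e' hc
      rcases hc with rfl | rfl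
      · exact absurd (e'.trans e.symm) (h.disj t ht b hb j hj hab htj)
      · rw [h.away t ht j hj a ha htj (Ne.symm hab) (e.trans e'.symm)]
  pair := by
    intro i j hi hi' hj hj' hij
    refine ⟨σ i j, ⟨mem_Icc.2 ⟨hi, hi'⟩, mem_Icc.2 ⟨hj, hj'⟩, hij, rfl⟩, ?_⟩
    rintro k ⟨-, -, -, e⟩
    exact e.symm

theorem IsTournament.exists_sched {n : ℕ} {T : Set (ℕ × ℕ × ℕ)} (hT : IsTournament n T) :
    ∃ σ, IsSched n σ ∧ T = matchSet n σ := by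
  have hex : ∀ i j, ∃ k, i ∈ Icc 1 n → j ∈ Icc 1 n → i ≠ j → (k, i, j) ∈ T := by
    intro i j
    by_cases hh : i ∈ Icc 1 n ∧ j ∈ Icc 1 n ∧ i ≠ j
    · obtain ⟨k, hk, -⟩ := hT.pair i j (mem_Icc.1 hh.1).1 (mem_Icc.1 hh.1).2
        (mem_Icc.1 hh.2.1).1 (mem_Icc.1 hh.2.1).2 hh.2.2
      exact ⟨k, fun _ _ _ => hk⟩
    · exact ⟨0, fun h1 h2 h3 => absurd ⟨h1, h2, h3⟩ hh⟩
  choose σ hσ using hex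
  have huniq : ∀ {k t i j i' j'}, t ∈ Icc 1 n → (k, i, j) ∈ T → (k, i', j') ∈ T →
      (t = i ∨ t = j) → (t = i' ∨ t = j') → i = i' ∧ j = j' := by
    intro k t i j i' j' ht h1 h2 c1 c2
    have hm := hT.subset _ h1
    have := (hT.slot_team k hm.1 hm.2.1 t (mem_Icc.1 ht).1 (mem_Icc.1 ht).2).unique
      ⟨h1, rfl, c1⟩ ⟨h2, rfl, c2⟩
    simpa using this
  refine ⟨σ, ⟨?_, ?_, ?_, ?_⟩, ?_⟩
  · intro i hi j hj hij
    have hm := hT.subset _ (hσ i j hi hj hij)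
    exact mem_Icc.2 ⟨hm.1, hm.2.1⟩
  · intro t ht j hj j' hj' h1 h2 e
    have a := hσ t j ht hj h1
    rw [e] at a
    exact (huniq ht a (hσ t j' ht hj' h2) (Or.inl rfl) (Or.inl rfl)).2
  · intro t ht j hj j' hj' h1 h2 e
    have a := hσ j t hj ht (Ne.symm h1)
    rw [e] at a
    exact (huniq ht a (hσ j' t hj' ht (Ne.symm h2)) (Or.inr rfl) (Or.inr rfl)).1
  · intro t ht j hj j' hj' h1 h2 e
    have a := hσ t j ht hj h1
    rw [e] at a
    exact h2 (huniq ht a (hσ j' t hj' ht (Ne.symm h2)) (Or.inl rfl) (Or.inr rfl)).1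
  · ext ⟨k, i, j⟩
    rw [mem_matchSet]
    constructor
    · intro hm
      have hm' := hT.subset _ hm
      obtain ⟨-, -, a, b, c, d, e⟩ := hm'
      refine ⟨mem_Icc.2 ⟨a, b⟩, mem_Icc.2 ⟨c, d⟩, e, ?_⟩
      exact (hT.pair i j a b c d e).unique
        (hσ i j (mem_Icc.2 ⟨a, b⟩) (mem_Icc.2 ⟨c, d⟩) e) hm
    · rintro ⟨hi, hj, hij, rfl⟩
      exact hσ i j hi hj hij

/-- Exchange the two matches between `p` and `q`. -/
def swapVenues (p q : ℕ) (σ : ℕ → ℕ → ℕ) (i j : ℕ) : ℕ :=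
  if (i = p ∧ j = q) ∨ (i = q ∧ j = p) then σ j i else σ i j

theorem swapVenues_left {p q : ℕ} {σ : ℕ → ℕ → ℕ} : swapVenues p q σ p q = σ q p := by simp [swapVenues]

theorem swapVenues_right {p q : ℕ} {σ : ℕ → ℕ → ℕ} : swapVenues p q σ q p = σ p q := by simp [swapVenues]

theorem swapVenues_of_ne {p q i j : ℕ} {σ : ℕ → ℕ → ℕ} (h : ¬ (i = p ∧ j = q)) (h' : ¬ (i = q ∧ j = p)) :
    swapVenues p q σ i j = σ i j := by simp [swapVenues, h, h']

theorem IsSched.swapVenues {n : ℕ} {σ : ℕ → ℕ → ℕ} (h : IsSched n σ) (p q : ℕ) :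
    IsSched n (swapVenues p q σ) where
  mem := by
    intro i hi j hj hij
    unfold TTP.swapVenues
    split_ifs
    · exact h.mem j hj i hi (Ne.symm hij)
    · exact h.mem i hi j hj hij
  home := by
    intro t ht j hj j' hj' h1 h2 e
    have a1 := h.home t ht j hj j' hj' h1 h2
    have a2 := h.away t ht j hj j' hj' h1 h2
    have a3 := h.disj t ht j hj j' hj' h1 h2
    have a4 := h.disj t ht j' hj' j hj h2 h1
    unfold TTP.swapVenues at e
    split_ifs at e <;> grind
  away := by
    intro t ht j hj j' hj' h1 h2 e
    have a1 := h.home t ht j hj j' hj' h1 h2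
    have a2 := h.away t ht j hj j' hj' h1 h2
    have a3 := h.disj t ht j hj j' hj' h1 h2
    have a4 := h.disj t ht j' hj' j hj h2 h1
    unfold TTP.swapVenues at e
    split_ifs at e <;> grind
  disj := by
    intro t ht j hj j' hj' h1 h2 e
    have a1 := h.home t ht j hj j' hj' h1 h2
    have a2 := h.away t ht j hj j' hj' h1 h2
    have a3 := h.disj t ht j hj j' hj' h1 h2
    have a4 := h.disj t ht j' hj' j hj h2 h1
    unfold TTP.swapVenues at e
    split_ifs at e <;> grind

/-- Slots can be permuted so that a given match takes place in a given slot. -/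
theorem IsSched.exists_slot_eq {n : ℕ} {σ : ℕ → ℕ → ℕ} (h : IsSched n σ) {u v k : ℕ}
    (hu : u ∈ Icc 1 n) (hv : v ∈ Icc 1 n) (huv : u ≠ v) (hk : k ∈ Icc 1 (2 * n - 2)) :
    ∃ τ, IsSched n τ ∧ τ u v = k ∧ ∀ i j, σ i j ≠ σ u v → σ i j ≠ k → τ i j = σ i j := by
  have hm := h.mem u hu v hv huv
  refine ⟨fun i j => Equiv.swap (σ u v) k (σ i j), ⟨?_, ?_, ?_, ?_⟩, Equiv.swap_apply_left _ _,
    fun i j h1 h2 => Equiv.swap_apply_of_ne_of_ne h1 h2⟩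
  · intro i hi j hj hij
    have := h.mem i hi j hj hij
    simp only [Equiv.swap_apply_def]
    split_ifs <;> assumption
  · intro t ht j hj j' hj' h1 h2 e
    exact h.home t ht j hj j' hj' h1 h2 ((Equiv.swap _ _).injective e)
  · intro t ht j hj j' hj' h1 h2 e
    exact h.away t ht j hj j' hj' h1 h2 ((Equiv.swap _ _).injective e)
  · intro t ht j hj j' hj' h1 h2 e
    exact h.disj t ht j hj j' hj' h1 h2 ((Equiv.swap _ _).injective e)

/-- The circle-method colouring of the edges of the complete graph on `{1,…,n}`. -/
def circleColor (n i j : ℕ) : ℕ :=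
  if j = n then (2 * i) % (n - 1) else if i = n then (2 * j) % (n - 1) else (i + j) % (n - 1)

theorem circleColor_comm (n i j : ℕ) : circleColor n i j = circleColor n j i := by
  unfold circleColor
  split_ifs with h1 h2 <;> simp_all [add_comm]

theorem eq_of_modEq_of_mem_Icc {m a b : ℕ} (ha : a ∈ Icc 1 m) (hb : b ∈ Icc 1 m)
    (h : a ≡ b [MOD m]) : a = b := by
  rw [mem_Icc] at ha hb
  have h' : (a - 1) + 1 ≡ (b - 1) + 1 [MOD m] := by
    rwa [Nat.sub_add_cancel ha.1, Nat.sub_add_cancel hb.1]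
  have := Nat.ModEq.eq_of_lt_of_lt (Nat.ModEq.add_right_cancel' 1 h') (by omega) (by omega)
  omega

theorem circleColor_injective {n t j j' : ℕ} (hn : 4 ≤ n) (he : Even n) (ht : t ∈ Icc 1 n)
    (hj : j ∈ Icc 1 n) (hj' : j' ∈ Icc 1 n) (h1 : t ≠ j) (h2 : t ≠ j')
    (h : circleColor n t j = circleColor n t j') : j = j' := by
  have hle : ∀ {a}, a ∈ Icc 1 n → a ≠ n → a ∈ Icc 1 (n - 1) := by
    intro a ha hne
    rw [mem_Icc] at ha ⊢
    omega
  have hcop : Nat.gcd (n - 1) 2 = 1 := by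
    have : Odd (n - 1) := Nat.Even.sub_odd (by omega) he odd_one
    exact (Nat.coprime_two_right.2 this)
  unfold circleColor at h
  split_ifs at h with c1 c2 c3 c4 c5
  · omega
  · omega
  · rw [two_mul] at h
    exact absurd (eq_of_modEq_of_mem_Icc (hle ht (by omega)) (hle hj' c2)
      (Nat.ModEq.add_left_cancel' t h)) h2
  · omega
  · exact eq_of_modEq_of_mem_Icc (hle hj c1) (hle hj' (by assumption))
      (Nat.ModEq.cancel_left_of_coprime hcop h)
  · rw [two_mul] at h
    exact absurd (eq_of_modEq_of_mem_Icc (hle hj c1) (hle ht c4)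
      (Nat.ModEq.add_left_cancel' t h)).symm h1
  · exact eq_of_modEq_of_mem_Icc (hle hj c1) (hle hj' (by assumption))
      (Nat.ModEq.add_left_cancel' t h)

theorem exists_isSched {n : ℕ} (hn : 4 ≤ n) (he : Even n) : ∃ σ, IsSched n σ := by
  have hlt : ∀ i j, circleColor n i j < n - 1 := by
    intro i j
    unfold circleColor
    split_ifs <;> exact Nat.mod_lt _ (by omega)
  refine ⟨fun i j => circleColor n i j + 1 + if i < j then 0 else n - 1, ⟨?_, ?_, ?_, ?_⟩⟩
  · intro i hi j hj hij
    have := hlt i j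
    rw [mem_Icc]
    split_ifs <;> omega
  all_goals
    intro t ht j hj j' hj' h1 h2
    have b1 := hlt t j
    have b2 := hlt t j'
    have inj := circleColor_injective hn he ht hj hj' h1 h2
    have e1 := circleColor_comm n j t
    have e2 := circleColor_comm n j' t
    intro e
    split_ifs at e
  all_goals omega

/-- Team `t` plays away in slot `s`. -/
def AwayAt (n : ℕ) (σ : ℕ → ℕ → ℕ) (t s : ℕ) : Prop := ∃ v ∈ Icc 1 n, t ≠ v ∧ σ v t = s

/-- Team `t` plays at home in slot `s`. -/
def HomeAt (n : ℕ) (σ : ℕ → ℕ → ℕ) (t s : ℕ) : Prop := ∃ v ∈ Icc 1 n, t ≠ v ∧ σ t v = s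

/-- The schedules whose play vector lies on the face, for a suitable travel vector. -/
def IsTight (n k i t : ℕ) (σ : ℕ → ℕ → ℕ) : Prop :=
  σ i t = k - 1 ∨ (σ i t = k ∧ (k = 2 * n - 2 ∨ AwayAt n σ t (k + 1))) ∨
    (HomeAt n σ t k ∧ (σ i t = 2 * n - 2 ∨ AwayAt n σ t (σ i t + 1)))

section Tight

variable {n k i t : ℕ}

/-- Each schedule becomes tight by exchanging venues of matches of `t`. -/
theorem induction_of_tight (hk : k ∈ Icc 1 (2 * n - 2))
    (hi : i ∈ Icc 1 n) (ht : t ∈ Icc 1 n) (hit : i ≠ t) (P : (ℕ → ℕ → ℕ) → Prop)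
    (hswap : ∀ σ, IsSched n σ → ∀ j ∈ Icc 1 n, t ≠ j → P (swapVenues t j σ) → P σ)
    (htight : ∀ σ, IsSched n σ → IsTight n k i t σ → P σ)
    {σ : ℕ → ℕ → ℕ} (h : IsSched n σ) : P σ := by
  have hti := Ne.symm hit
  have key : ∀ σ, IsSched n σ → ∀ j ∈ Icc 1 n, t ≠ j → σ t j = k → σ i t + 1 ≠ k →
      σ t i ≠ σ i t + 1 → P σ := by
    intro σ h j hj htj hjk h1 h2
    by_cases hl : σ i t = 2 * n - 2
    · exact htight σ h (Or.inr (Or.inr ⟨⟨j, hj, htj, hjk⟩, Or.inl hl⟩))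
    · have hm := h.mem i hi t ht hit
      obtain ⟨v, hv, htv, e | e⟩ := h.exists_opponent (k := σ i t + 1) ht
        (by rw [mem_Icc] at hm ⊢; omega)
      · have hvi : v ≠ i := by rintro rfl; exact h2 e
        have hvj : v ≠ j := by rintro rfl; omega
        refine hswap σ h v hv htv (htight _ (h.swapVenues t v) (Or.inr (Or.inr ⟨⟨j, hj, htj, ?_⟩,
          Or.inr ⟨v, hv, htv, ?_⟩⟩)))
        · rw [swapVenues_of_ne (by tauto) (by tauto), hjk]
        · rw [swapVenues_right, swapVenues_of_ne (by tauto) (by tauto), e]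
      · exact htight σ h (Or.inr (Or.inr ⟨⟨j, hj, htj, hjk⟩, Or.inr ⟨v, hv, htv, e⟩⟩))
  have hC : ∀ σ, IsSched n σ → σ i t = k → P σ := by
    intro σ h e
    by_cases hl : k = 2 * n - 2
    · exact htight σ h (Or.inr (Or.inl ⟨e, Or.inl hl⟩))
    · obtain ⟨v, hv, htv, e' | e'⟩ := h.exists_opponent (k := k + 1) ht
        (by rw [mem_Icc] at hk ⊢; omega)
      · by_cases hvi : v = i
        · subst hvi
          refine hswap σ h v hv htv (key _ (h.swapVenues t v) v hv htv ?_ ?_ ?_)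
          · rw [swapVenues_left, e]
          · rw [swapVenues_right]; omega
          · rw [swapVenues_left, swapVenues_right]; omega
        · refine hswap σ h v hv htv (htight _ (h.swapVenues t v) (Or.inr (Or.inl ⟨?_,
            Or.inr ⟨v, hv, htv, ?_⟩⟩)))
          · rw [swapVenues_of_ne (by tauto) (by tauto), e]
          · rw [swapVenues_right, e']
      · exact htight σ h (Or.inr (Or.inl ⟨e, Or.inr ⟨v, hv, htv, e'⟩⟩))
  have hE : ∀ σ, IsSched n σ → ∀ j ∈ Icc 1 n, t ≠ j → j ≠ i → σ t j = k → σ i t ≠ k - 1 →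
      σ t i ≠ k - 1 → P σ := by
    intro σ h j hj htj hji hjk h1 h2
    rw [mem_Icc] at hk
    by_cases hc : σ t i = σ i t + 1
    · refine hswap σ h i hi hti (key _ (h.swapVenues t i) j hj htj ?_ ?_ ?_)
      · rw [swapVenues_of_ne (by tauto) (by tauto), hjk]
      · rw [swapVenues_right]; omega
      · rw [swapVenues_left, swapVenues_right]; omega
    · exact key σ h j hj htj hjk (by omega) hc
  by_cases a1 : σ i t = k - 1
  · exact htight σ h (Or.inl a1)
  by_cases a2 : σ t i = k - 1
  · exact hswap σ h i hi hti (htight _ (h.swapVenues t i) (Or.inl (by rw [swapVenues_right, a2])))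
  by_cases a3 : σ i t = k
  · exact hC σ h a3
  by_cases a4 : σ t i = k
  · exact hswap σ h i hi hti (hC _ (h.swapVenues t i) (by rw [swapVenues_right, a4]))
  obtain ⟨j, hj, htj, e | e⟩ := h.exists_opponent ht hk
  · exact hE σ h j hj htj (by rintro rfl; exact a4 e) e a1 a2
  · have hji : j ≠ i := by rintro rfl; exact a3 e
    refine hswap σ h j hj htj (hE _ (h.swapVenues t j) j hj htj hji ?_ ?_ ?_)
    · rw [swapVenues_left, e]
    · rwa [swapVenues_of_ne (by tauto) (by tauto)]
    · rwa [swapVenues_of_ne (by tauto) (by tauto)]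

/-- The slot of the match between `t` and `v`, at venue `t` if `b` holds and at `v` otherwise. -/
def meet (σ : ℕ → ℕ → ℕ) (t v : ℕ) (b : Bool) : ℕ := if b then σ t v else σ v t

theorem IsSched.meet_injective {σ : ℕ → ℕ → ℕ} (h : IsSched n σ) (ht : t ∈ Icc 1 n) {u v : ℕ}
    {b c : Bool} (hu : u ∈ Icc 1 n) (hv : v ∈ Icc 1 n) (htu : t ≠ u) (htv : t ≠ v)
    (e : meet σ t u b = meet σ t v c) : (u, b) = (v, c) := by
  have a1 := h.home t ht u hu v hv htu htv
  have a2 := h.away t ht u hu v hv htu htv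
  have a3 := h.disj t ht u hu v hv htu htv
  have a4 := h.disj t ht v hv u hu htv htu
  cases b <;> cases c <;> simp_all [meet]

/-- The slots of the matches of one team can be prescribed arbitrarily. -/
theorem exists_isSched_of_list (hn : 4 ≤ n) (he : Even n) (ht : t ∈ Icc 1 n)
    (L : List ((ℕ × Bool) × ℕ))
    (hL : ∀ x ∈ L, x.1.1 ∈ Icc 1 n ∧ t ≠ x.1.1 ∧ x.2 ∈ Icc 1 (2 * n - 2))
    (hp : L.Pairwise fun x y => x.1 ≠ y.1 ∧ x.2 ≠ y.2) :
    ∃ σ, IsSched n σ ∧ ∀ x ∈ L, meet σ t x.1.1 x.1.2 = x.2 := by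
  induction L with
  | nil =>
    obtain ⟨σ, h⟩ := exists_isSched hn he
    exact ⟨σ, h, by simp⟩
  | cons x L ih =>
    rw [List.pairwise_cons] at hp
    obtain ⟨σ, h, hσ⟩ := ih (fun y hy => hL y (List.mem_cons_of_mem _ hy)) hp.2
    obtain ⟨⟨v, b⟩, s⟩ := x
    obtain ⟨hv, htv, hs⟩ := hL _ List.mem_cons_self
    have : ∃ τ, IsSched n τ ∧ meet τ t v b = s ∧
        ∀ u c, meet σ t u c ≠ meet σ t v b → meet σ t u c ≠ s → meet τ t u c = meet σ t u c := by
      cases b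
      · obtain ⟨τ, h1, h2, h3⟩ := h.exists_slot_eq hv ht (Ne.symm htv) hs
        refine ⟨τ, h1, h2, ?_⟩
        rintro u (_ | _) <;> exact h3 _ _
      · obtain ⟨τ, h1, h2, h3⟩ := h.exists_slot_eq ht hv htv hs
        refine ⟨τ, h1, h2, ?_⟩
        rintro u (_ | _) <;> exact h3 _ _
    obtain ⟨τ, h1, h2, h3⟩ := this
    refine ⟨τ, h1, ?_⟩
    intro y hy
    rcases List.mem_cons.1 hy with rfl | hy'
    · exact h2
    · obtain ⟨hyv, hty, -⟩ := hL y hy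
      obtain ⟨hne, hne'⟩ := hp.1 y hy'
      rw [h3, hσ y hy']
      · exact fun e => hne (h.meet_injective ht hyv hv hty htv e).symm
      · rw [hσ y hy']
        exact Ne.symm hne'

theorem exists_mem_Icc_ne {N : ℕ} (hN : 4 ≤ N) (a b c : ℕ) :
    ∃ r ∈ Icc 1 N, r ≠ a ∧ r ≠ b ∧ r ≠ c := by
  have hlt : ({a, b, c} : Finset ℕ).card < (Icc 1 N).card := by
    have := Finset.card_le_three (a := a) (b := b) (c := c)
    simp only [Nat.card_Icc]
    omega
  obtain ⟨r, hr, hr'⟩ := Finset.exists_mem_notMem_of_card_lt_card hlt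
  simp only [mem_insert, mem_singleton, not_or] at hr'
  exact ⟨r, hr, hr'⟩

/-- A function of the slots that is preserved under exchanges of the matches between `t` and
`j ≠ i` among tight schedules is constant. -/
theorem slot_const_of_ne (hn : 4 ≤ n) (he : Even n) (hk : k ∈ Icc 1 (2 * n - 2)) (hk1 : k ≠ 1)
    (hi : i ∈ Icc 1 n) (ht : t ∈ Icc 1 n) (hit : i ≠ t) {j : ℕ} (hj : j ∈ Icc 1 n) (htj : t ≠ j)
    (hji : j ≠ i) (d : ℕ → ℝ)
    (hd : ∀ σ, IsSched n σ → IsTight n k i t σ → IsTight n k i t (swapVenues t j σ) →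
      d (σ t j) = d (σ j t)) :
    ∀ a ∈ Icc 1 (2 * n - 2), ∀ b ∈ Icc 1 (2 * n - 2), d a = d b := by
  have hti := Ne.symm hit
  have hjt := Ne.symm htj
  have hij := Ne.symm hji
  have hkm : k - 1 ∈ Icc 1 (2 * n - 2) := by rw [mem_Icc] at hk ⊢; omega
  have hoff : ∀ a ∈ Icc 1 (2 * n - 2), ∀ b ∈ Icc 1 (2 * n - 2), a ≠ k - 1 → b ≠ k - 1 →
      d a = d b := by
    intro a ha b hb hak hbk
    by_cases hab : a = b
    · rw [hab]
    obtain ⟨σ, h, hσ⟩ := exists_isSched_of_list hn he ht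
      [((i, false), k - 1), ((j, true), a), ((j, false), b)]
      (by simp [*]; grind) (by simp [*, Ne.symm hak, Ne.symm hbk])
    simp only [List.mem_cons, List.not_mem_nil, or_false, forall_eq_or_imp, forall_eq, meet] at hσ
    simp only [if_true, if_false, Bool.false_eq_true] at hσ
    obtain ⟨s1, s2, s3⟩ := hσ
    rw [← s2, ← s3]
    refine hd σ h (Or.inl s1) (Or.inl ?_)
    rw [swapVenues_of_ne (by tauto) (by tauto), s1]
  have hon : ∃ b ∈ Icc 1 (2 * n - 2), b ≠ k - 1 ∧ d (k - 1) = d b := by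
    obtain ⟨b, hb, b1, b2, b3⟩ := exists_mem_Icc_ne (N := 2 * n - 2) (by omega) (k - 1) k (k + 1)
    refine ⟨b, hb, b1, ?_⟩
    have : ∃ σ, IsSched n σ ∧ σ i t = k ∧ σ t j = k - 1 ∧ σ j t = b ∧
        (k = 2 * n - 2 ∨ ∃ r ∈ Icc 1 n, t ≠ r ∧ r ≠ j ∧ σ r t = k + 1) := by
      by_cases hkl : k = 2 * n - 2
      · obtain ⟨σ, h, hσ⟩ := exists_isSched_of_list hn he ht
          [((i, false), k), ((j, true), k - 1), ((j, false), b)]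
          (by simp [*]; grind) (by simp [*]; grind)
        simp [meet] at hσ
        exact ⟨σ, h, hσ.1, hσ.2.1, hσ.2.2, Or.inl hkl⟩
      · obtain ⟨r, hr, r1, r2, r3⟩ := exists_mem_Icc_ne hn t i j
        obtain ⟨σ, h, hσ⟩ := exists_isSched_of_list hn he ht
          [((i, false), k), ((j, true), k - 1), ((j, false), b), ((r, false), k + 1)]
          (by simp [*]; grind) (by simp [*]; grind)
        simp [meet] at hσ
        exact ⟨σ, h, hσ.1, hσ.2.1, hσ.2.2.1, Or.inr ⟨r, hr, Ne.symm r1, r3, hσ.2.2.2⟩⟩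
    obtain ⟨σ, h, s1, s2, s3, s4⟩ := this
    rw [← s2, ← s3]
    refine hd σ h (Or.inr (Or.inl ⟨s1, s4.imp_right ?_⟩)) (Or.inr (Or.inl ⟨?_, s4.imp_right ?_⟩))
    · rintro ⟨r, hr, htr, -, e⟩
      exact ⟨r, hr, htr, e⟩
    · rw [swapVenues_of_ne (by tauto) (by tauto), s1]
    · rintro ⟨r, hr, htr, hrj, e⟩
      exact ⟨r, hr, htr, by rw [swapVenues_of_ne (by tauto) (by tauto), e]⟩
  obtain ⟨c, hc, hck, hce⟩ := hon
  have hall : ∀ a ∈ Icc 1 (2 * n - 2), d a = d c := by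
    intro a ha
    by_cases hak : a = k - 1
    · rw [hak, hce]
    · exact hoff a ha c hc hak hck
  intro a ha b hb
  rw [hall a ha, hall b hb]

/-- A function of the slots that is preserved under exchanges of the matches between `t` and
`i` among tight schedules is constant. -/
theorem slot_const_self (hn : 4 ≤ n) (he : Even n) (hk : k ∈ Icc 1 (2 * n - 2)) (hk1 : k ≠ 1)
    (hi : i ∈ Icc 1 n) (ht : t ∈ Icc 1 n) (hit : i ≠ t) (d : ℕ → ℝ)
    (hd : ∀ σ, IsSched n σ → IsTight n k i t σ → IsTight n k i t (swapVenues t i σ) →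
      d (σ t i) = d (σ i t)) :
    ∀ a ∈ Icc 1 (2 * n - 2), ∀ b ∈ Icc 1 (2 * n - 2), d a = d b := by
  have hti := Ne.symm hit
  have hkm : k - 1 ∈ Icc 1 (2 * n - 2) := by rw [mem_Icc] at hk ⊢; omega
  obtain ⟨r, hr, r1, r2, -⟩ := exists_mem_Icc_ne hn t i i
  obtain ⟨q, hq, q1, q2, q3⟩ := exists_mem_Icc_ne hn t i r
  have htr := Ne.symm r1
  have htq := Ne.symm q1
  have hk' : d k = d (k - 1) := by
    have : ∃ σ, IsSched n σ ∧ σ i t = k - 1 ∧ σ t i = k ∧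
        (k = 2 * n - 2 ∨ σ r t = k + 1) := by
      by_cases hkl : k = 2 * n - 2
      · obtain ⟨σ, h, hσ⟩ := exists_isSched_of_list hn he ht
          [((i, false), k - 1), ((i, true), k)]
          (by simp [*]; grind) (by simp [*]; grind)
        simp [meet] at hσ
        exact ⟨σ, h, hσ.1, hσ.2, Or.inl hkl⟩
      · obtain ⟨σ, h, hσ⟩ := exists_isSched_of_list hn he ht
          [((i, false), k - 1), ((i, true), k), ((r, false), k + 1)]
          (by simp [*]; grind) (by simp [*]; grind)
        simp [meet] at hσ
        exact ⟨σ, h, hσ.1, hσ.2.1, Or.inr hσ.2.2⟩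
    obtain ⟨σ, h, s1, s2, s3⟩ := this
    rw [← s1, ← s2]
    refine hd σ h (Or.inl s1) (Or.inr (Or.inl ⟨?_, s3.imp_right fun e => ⟨r, hr, htr, ?_⟩⟩))
    · rw [swapVenues_right, s2]
    · rw [swapVenues_of_ne (by tauto) (by tauto), e]
  have hall : ∀ m ∈ Icc 1 (2 * n - 2), d m = d (k - 1) := by
    intro m hm
    by_cases m1 : m = k
    · rw [m1, hk']
    by_cases m2 : m = k - 1
    · rw [m2]
    by_cases m3 : m = 2 * n - 2
    · obtain ⟨σ, h, hσ⟩ := exists_isSched_of_list hn he ht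
        [((i, false), k - 1), ((i, true), m), ((r, true), k)]
        (by simp [*]; grind) (by simp [*]; grind)
      simp [meet] at hσ
      obtain ⟨s1, s2, s3⟩ := hσ
      rw [← s1, ← s2]
      refine hd σ h (Or.inl s1) (Or.inr (Or.inr ⟨⟨r, hr, htr, ?_⟩, Or.inl ?_⟩))
      · rw [swapVenues_of_ne (by tauto) (by tauto), s3]
      · rw [swapVenues_right, s2, m3]
    by_cases m4 : m + 1 = k - 1
    · have : ∃ σ, IsSched n σ ∧ σ i t = k ∧ σ t i = m ∧ σ r t = k - 1 ∧
          (k = 2 * n - 2 ∨ σ q t = k + 1) := by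
        by_cases hkl : k = 2 * n - 2
        · obtain ⟨σ, h, hσ⟩ := exists_isSched_of_list hn he ht
            [((i, false), k), ((i, true), m), ((r, false), k - 1)]
            (by simp [*]; grind) (by simp [*]; grind)
          simp [meet] at hσ
          exact ⟨σ, h, hσ.1, hσ.2.1, hσ.2.2, Or.inl hkl⟩
        · obtain ⟨σ, h, hσ⟩ := exists_isSched_of_list hn he ht
            [((i, false), k), ((i, true), m), ((r, false), k - 1), ((q, false), k + 1)]
            (by simp [*]; grind) (by simp [*]; grind)
          simp [meet] at hσ
          exact ⟨σ, h, hσ.1, hσ.2.1, hσ.2.2.1, Or.inr hσ.2.2.2⟩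
      obtain ⟨σ, h, s1, s2, s3, s4⟩ := this
      rw [← hk', ← s1, ← s2]
      refine hd σ h (Or.inr (Or.inl ⟨s1, s4.imp_right fun e => ⟨q, hq, htq, e⟩⟩))
        (Or.inr (Or.inr ⟨⟨i, hi, hti, ?_⟩, Or.inr ⟨r, hr, htr, ?_⟩⟩))
      · rw [swapVenues_left, s1]
      · rw [swapVenues_right, swapVenues_of_ne (by tauto) (by tauto), s3, s2, m4]
    · obtain ⟨σ, h, hσ⟩ := exists_isSched_of_list hn he ht
        [((i, false), k - 1), ((i, true), m), ((r, true), k), ((q, false), m + 1)]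
        (by simp [*]; grind) (by simp [*]; grind)
      simp [meet] at hσ
      obtain ⟨s1, s2, s3, s4⟩ := hσ
      rw [← s1, ← s2]
      refine hd σ h (Or.inl s1) (Or.inr (Or.inr ⟨⟨r, hr, htr, ?_⟩, Or.inr ⟨q, hq, htq, ?_⟩⟩))
      · rw [swapVenues_of_ne (by tauto) (by tauto), s3]
      · rw [swapVenues_right, swapVenues_of_ne (by tauto) (by tauto), s4, s2]
  intro a ha b hb
  rw [hall a ha, hall b hb]

end Tight

section Travel

variable {n : ℕ} {σ : ℕ → ℕ → ℕ}

theorem IsSched.venue_of_away (h : IsSched n σ) {t v : ℕ} (ht : t ∈ Icc 1 n)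
    (hv : v ∈ Icc 1 n) (htv : t ≠ v) : venue (matchSet n σ) t (σ v t) = v := by
  have hex : ∃ i, ∃ j, (σ v t, i, j) ∈ matchSet n σ ∧ (t = i ∨ t = j) :=
    ⟨v, t, ⟨hv, ht, Ne.symm htv, rfl⟩, Or.inr rfl⟩
  unfold venue
  rw [dif_pos hex]
  obtain ⟨j, hm, hc⟩ := hex.choose_spec
  obtain ⟨hi, hj, hij, e⟩ := mem_matchSet.1 hm
  rcases hc with hc | rfl
  · rw [← hc] at e hij
    exact absurd e (h.disj t ht j hj v hv hij htv)
  · exact h.away t ht _ hi v hv (Ne.symm hij) htv e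

theorem venue_of_not_away {t s : ℕ} (hs : ¬ AwayAt n σ t s) : venue (matchSet n σ) t s = t := by
  unfold venue
  split_ifs with hex
  · obtain ⟨j, hm, hc⟩ := hex.choose_spec
    obtain ⟨hi, hj, hij, e⟩ := mem_matchSet.1 hm
    rcases hc with hc | rfl
    · exact hc.symm
    · exact absurd ⟨_, hi, Ne.symm hij, e⟩ hs
  · rfl

theorem IsSched.venue_eq_iff (h : IsSched n σ) {t v s : ℕ} (ht : t ∈ Icc 1 n)
    (hv : v ∈ Icc 1 n) (htv : t ≠ v) : venue (matchSet n σ) t s = v ↔ σ v t = s := by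
  constructor
  · intro e
    by_cases hs : AwayAt n σ t s
    · obtain ⟨u, hu, htu, rfl⟩ := hs
      rw [h.venue_of_away ht hu htu] at e
      rw [e]
    · rw [venue_of_not_away hs] at e
      exact absurd e htv
  · rintro rfl
    exact h.venue_of_away ht hv htv

theorem IsSched.venue_eq_self_iff (h : IsSched n σ) {t s : ℕ} (ht : t ∈ Icc 1 n) :
    venue (matchSet n σ) t s = t ↔ ¬ AwayAt n σ t s := by
  constructor
  · rintro e ⟨u, hu, htu, rfl⟩
    rw [h.venue_of_away ht hu htu] at e
    exact htu e.symm
  · exact venue_of_not_away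

theorem travel_eq_zero {p : ℕ × ℕ × ℕ}
    (h : ∀ s, s ≤ 2 * n - 2 → venue (matchSet n σ) p.1 s = p.2.1 →
      venue (matchSet n σ) p.1 (s + 1) ≠ p.2.2) : travel n (matchSet n σ) p = 0 := by
  unfold travel
  rw [if_neg]
  rintro ⟨s, hs, h1, h2⟩
  exact h s hs h1 h2

/-- Team `t` travels home from `i` iff its match at `i` is not followed by an away match. -/
theorem IsSched.travel_home (h : IsSched n σ) {i t : ℕ} (hi : i ∈ Icc 1 n) (ht : t ∈ Icc 1 n)
    (hit : i ≠ t) :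
    travel n (matchSet n σ) (t, i, t) = if AwayAt n σ t (σ i t + 1) then 0 else 1 := by
  have hm := mem_Icc.1 (h.mem i hi t ht hit)
  split_ifs with ha
  · refine travel_eq_zero fun s _ h1 h2 => ?_
    rw [h.venue_eq_iff ht hi (Ne.symm hit)] at h1
    rw [h.venue_eq_self_iff ht, ← h1] at h2
    exact h2 ha
  · unfold travel
    exact if_pos ⟨σ i t, hm.2, h.venue_of_away ht hi (Ne.symm hit), venue_of_not_away ha⟩

variable {k i t : ℕ}

theorem exists_isSched_consecutive_away (hn : 4 ≤ n) (he : Even n)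
    (hk : k ∈ Icc 1 (2 * n - 2)) (hk1 : k ≠ 1) (hi : i ∈ Icc 1 n) (ht : t ∈ Icc 1 n) (hit : i ≠ t)
    {w u s s' : ℕ} (hw : w ∈ Icc 1 n) (hu : u ∈ Icc 1 n) (hwu : w ≠ u) (hne : ¬ (w = i ∧ u = t))
    (hs : s ∈ Icc 1 (2 * n - 2)) (hs' : s' ∈ Icc 1 (2 * n - 2)) (hss : s ≠ s')
    (hsk : s ≠ k - 1) (hsk' : s' ≠ k - 1) :
    ∃ σ, IsSched n σ ∧ σ i t = k - 1 ∧ σ w u = s ∧ ∃ r ∈ Icc 1 n, r ≠ u ∧ r ≠ w ∧ σ r u = s' := by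
  have hkm : k - 1 ∈ Icc 1 (2 * n - 2) := by rw [mem_Icc] at hk ⊢; omega
  obtain ⟨σ₀, h₀⟩ := exists_isSched hn he
  obtain ⟨σ₁, h₁, e₁, -⟩ := h₀.exists_slot_eq hi ht hit hkm
  have h2 : ∃ σ, IsSched n σ ∧ σ i t = k - 1 ∧ σ w u ≠ k - 1 := by
    by_cases hc : σ₁ w u = k - 1
    · refine ⟨swapVenues w u σ₁, h₁.swapVenues w u, ?_, ?_⟩
      · rw [swapVenues_of_ne (by tauto), e₁]
        rintro ⟨rfl, rfl⟩
        exact h₁.disj i hi t ht t ht hit hit (e₁.trans hc.symm)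
      · rw [swapVenues_left]
        intro e
        exact h₁.disj w hw u hu u hu hwu hwu (hc.trans e.symm)
    · exact ⟨σ₁, h₁, e₁, hc⟩
  obtain ⟨σ₂, h₂, e₂, f₂⟩ := h2
  obtain ⟨σ₃, h₃, e₃, f₃⟩ := h₂.exists_slot_eq hw hu hwu hs
  replace f₃ : σ₃ i t = k - 1 := by
    rw [f₃ i t (by rw [e₂]; exact Ne.symm f₂) (by rw [e₂]; exact Ne.symm hsk), e₂]
  obtain ⟨r, hr, r1, r2, r3⟩ := exists_mem_Icc_ne hn u w (if u = t then i else t)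
  have hri : ¬ (i = r ∧ t = u) := by
    rintro ⟨rfl, rfl⟩
    simp at r3
  have hri' : ¬ (i = u ∧ t = r) := by
    rintro ⟨rfl, rfl⟩
    simp [hit] at r3
  have h4 : ∃ σ, IsSched n σ ∧ σ i t = k - 1 ∧ σ w u = s ∧ σ r u ≠ k - 1 := by
    by_cases hc : σ₃ r u = k - 1
    · refine ⟨swapVenues r u σ₃, h₃.swapVenues r u, ?_, ?_, ?_⟩
      · rw [swapVenues_of_ne hri hri', f₃]
      · rw [swapVenues_of_ne (by tauto) (by tauto), e₃]
      · rw [swapVenues_left]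
        intro e
        exact h₃.disj r hr u hu u hu r1 r1 (hc.trans e.symm)
    · exact ⟨σ₃, h₃, f₃, e₃, hc⟩
  obtain ⟨σ₄, h₄, e₄, f₄, g₄⟩ := h4
  obtain ⟨σ₅, h₅, e₅, f₅⟩ := h₄.exists_slot_eq hr hu r1 hs'
  refine ⟨σ₅, h₅, ?_, ?_, r, hr, r1, r2, e₅⟩
  · rw [f₅ i t (by rw [e₄]; exact Ne.symm g₄) (by rw [e₄]; exact Ne.symm hsk'), e₄]
  · rw [f₅ w u _ (by rw [f₄]; exact hss), f₄]
    intro e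
    exact r2 (h₄.away u hu w hw r hr (Ne.symm hwu) (Ne.symm r1) e).symm

/-- Every trip other than the one from `i` to `t` by team `t` is avoided by a tight schedule. -/
theorem exists_isTight_travel_eq_zero (hn : 4 ≤ n) (he : Even n)
    (hk : k ∈ Icc 1 (2 * n - 2)) (hk1 : k ≠ 1) (hi : i ∈ Icc 1 n) (ht : t ∈ Icc 1 n) (hit : i ≠ t)
    {u a b : ℕ} (hu : u ∈ Icc 1 n) (ha : a ∈ Icc 1 n) (hb : b ∈ Icc 1 n) (hab : a ≠ b)
    (hne : (u, a, b) ≠ (t, i, t)) :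
    ∃ σ, IsSched n σ ∧ IsTight n k i t σ ∧ travel n (matchSet n σ) (u, a, b) = 0 := by
  have hkm : k - 1 ∈ Icc 1 (2 * n - 2) := by rw [mem_Icc] at hk ⊢; omega
  obtain ⟨s, hs, hs', hsk, hsk'⟩ : ∃ s, s ∈ Icc 1 (2 * n - 2) ∧ s + 1 ∈ Icc 1 (2 * n - 2) ∧
      s ≠ k - 1 ∧ s + 1 ≠ k - 1 := by
    simp only [mem_Icc]
    by_cases k - 1 ≤ 2
    · exact ⟨3, by omega⟩
    · exact ⟨1, by omega⟩
  by_cases hbu : b = u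
  · subst hbu
    obtain ⟨σ, h, e1, e2, r, hr, hrb, hra, e3⟩ := exists_isSched_consecutive_away hn he hk hk1 hi ht
      hit ha hu hab (by rintro ⟨rfl, rfl⟩; exact hne rfl) hs hs' (by omega) hsk hsk'
    refine ⟨σ, h, Or.inl e1, ?_⟩
    rw [h.travel_home ha hu hab, if_pos ⟨r, hr, Ne.symm hrb, by rw [e3, e2]⟩]
  by_cases hau : a = u
  · subst hau
    have : ∃ σ, IsSched n σ ∧ IsTight n k i t σ ∧ ∃ r ∈ Icc 1 n, r ≠ a ∧ σ b a = σ r a + 1 := by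
      by_cases hc : b = i ∧ a = t
      · obtain ⟨rfl, rfl⟩ := hc
        obtain ⟨r, hr, r1, r2, -⟩ := exists_mem_Icc_ne hn a b b
        obtain ⟨q, hq, q1, q2, q3⟩ := exists_mem_Icc_ne hn a b r
        by_cases hkl : k = 2 * n - 2
        · obtain ⟨σ, h, hσ⟩ := exists_isSched_of_list hn he ha
            [((b, false), k), ((r, false), k - 1)]
            (by simp [*]; grind) (by simp [*]; grind)
          simp [meet] at hσ
          exact ⟨σ, h, Or.inr (Or.inl ⟨hσ.1, Or.inl hkl⟩), r, hr, r1,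
            by rw [hσ.1, hσ.2]; rw [mem_Icc] at hk; omega⟩
        · obtain ⟨σ, h, hσ⟩ := exists_isSched_of_list hn he ha
            [((b, false), k), ((r, false), k - 1), ((q, false), k + 1)]
            (by simp [*]; grind) (by simp [*]; grind)
          simp [meet] at hσ
          exact ⟨σ, h, Or.inr (Or.inl ⟨hσ.1, Or.inr ⟨q, hq, Ne.symm q1, hσ.2.2⟩⟩), r, hr, r1,
            by rw [hσ.1, hσ.2.1]; rw [mem_Icc] at hk; omega⟩
      · obtain ⟨σ, h, e1, e2, r, hr, hrb, hra, e3⟩ := exists_isSched_consecutive_away hn he hk hk1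
          hi ht hit hb hu hbu hc hs' hs (by omega) hsk' hsk
        exact ⟨σ, h, Or.inl e1, r, hr, hrb, by rw [e3, e2]⟩
    obtain ⟨σ, h, htight, r, hr, hra, e⟩ := this
    refine ⟨σ, h, htight, travel_eq_zero fun s _ h1 h2 => ?_⟩
    rw [h.venue_eq_iff hu hb hab] at h2
    rw [h.venue_eq_self_iff hu] at h1
    exact h1 ⟨r, hr, Ne.symm hra, by omega⟩
  have hzero : ∀ σ, IsSched n σ → σ b u ≠ σ a u + 1 → travel n (matchSet n σ) (u, a, b) = 0 := by
    intro σ h hs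
    refine travel_eq_zero fun s _ h1 h2 => ?_
    rw [h.venue_eq_iff hu ha (Ne.symm hau)] at h1
    rw [h.venue_eq_iff hu hb (Ne.symm hbu), ← h1] at h2
    exact hs h2
  obtain ⟨σ₀, h₀⟩ := exists_isSched hn he
  obtain ⟨σ, h, e, -⟩ := h₀.exists_slot_eq hi ht hit hkm
  by_cases hc : σ b u = σ a u + 1
  · by_cases hbi : (i = b ∧ t = u) ∨ (i = u ∧ t = b)
    · refine ⟨swapVenues a u σ, h.swapVenues a u, Or.inl ?_, hzero _ (h.swapVenues a u) ?_⟩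
      · rw [swapVenues_of_ne (by grind) (by grind), e]
      · rw [swapVenues_of_ne (by grind) (by grind), swapVenues_left, hc]
        intro e'
        exact h.disj u hu a ha a ha (Ne.symm hau) (Ne.symm hau) (by omega)
    · refine ⟨swapVenues b u σ, h.swapVenues b u, Or.inl ?_, hzero _ (h.swapVenues b u) ?_⟩
      · rw [swapVenues_of_ne (by tauto) (by tauto), e]
      · rw [swapVenues_left, swapVenues_of_ne (by grind) (by grind), ← hc]
        intro e'
        exact h.disj u hu b hb b hb (Ne.symm hbu) (Ne.symm hbu) (by omega)
  · exact ⟨σ, h, Or.inl e, hzero σ h hc⟩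

end Travel

section Vertices

variable {n : ℕ} {σ : ℕ → ℕ → ℕ}

theorem IsMatch.mem_Icc {s a b : ℕ} (h : IsMatch n (s, a, b)) :
    a ∈ Icc 1 n ∧ b ∈ Icc 1 n ∧ a ≠ b :=
  ⟨Finset.mem_Icc.2 ⟨h.2.2.1, h.2.2.2.1⟩, Finset.mem_Icc.2 ⟨h.2.2.2.2.1, h.2.2.2.2.2.1⟩,
    h.2.2.2.2.2.2⟩

theorem play_matchSet {s a b : ℕ} (ha : a ∈ Icc 1 n) (hb : b ∈ Icc 1 n) (hab : a ≠ b) :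
    play (matchSet n σ) (s, a, b) = if σ a b = s then 1 else 0 := by
  unfold play
  rw [mem_matchSet]
  simp [ha, hb, hab]

/-- The play vector of a schedule. -/
noncomputable def playVec (n : ℕ) (σ : ℕ → ℕ → ℕ) : {m : ℕ × ℕ × ℕ // IsMatch n m} → ℝ :=
  fun m => play (matchSet n σ) m.1

/-- The indicator vector of a match. -/
noncomputable def matchVec (n s a b : ℕ) : {m : ℕ × ℕ × ℕ // IsMatch n m} → ℝ :=
  fun m => if m.1 = (s, a, b) then 1 else 0

theorem playVec_sub_swapVenues {t j : ℕ} (htj : t ≠ j) :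
    playVec n σ - playVec n (swapVenues t j σ) =
      (matchVec n (σ t j) t j - matchVec n (σ t j) j t) -
        (matchVec n (σ j t) t j - matchVec n (σ j t) j t) := by
  ext ⟨⟨s, a, b⟩, hm⟩
  obtain ⟨ha, hb, hab⟩ := hm.mem_Icc
  simp only [Pi.sub_apply, playVec, matchVec, play_matchSet ha hb hab, Prod.mk.injEq]
  by_cases h1 : a = t ∧ b = j
  · obtain ⟨rfl, rfl⟩ := h1
    simp [swapVenues_left, hab, eq_comm]
  by_cases h2 : a = j ∧ b = t
  · obtain ⟨rfl, rfl⟩ := h2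
    simp [swapVenues_right, hab, Ne.symm hab, eq_comm]
    ring
  · rw [swapVenues_of_ne h1 h2]
    simp [h1, h2]

theorem IsSched.xval_eq (h : IsSched n σ) (y : {p : ℕ × ℕ × ℕ // IsTravelIdx n p} → ℝ) {s a b : ℕ}
    (ha : a ∈ Icc 1 n) (hb : b ∈ Icc 1 n) (hab : a ≠ b) :
    xval ((playVec n σ, y) : Pt n) s a b = if σ a b = s then 1 else 0 := by
  unfold xval
  split_ifs with h1 h2 h2
  · simp [playVec, play_matchSet ha hb hab, h2]
  · simp [playVec, play_matchSet ha hb hab, h2]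
  · have := h.mem a ha b hb hab
    rw [h2] at this
    rw [Finset.mem_Icc] at this ha hb
    exact absurd ⟨this.1, this.2, ha.1, ha.2, hb.1, hb.2, hab⟩ h1
  · rfl

theorem IsSched.mem_Ptt (h : IsSched n σ) {y : {p : ℕ × ℕ × ℕ // IsTravelIdx n p} → ℝ}
    (hy : ∀ p, y p = 0 ∨ y p = 1) (hle : ∀ p, travel n (matchSet n σ) p.1 ≤ y p) :
    ((playVec n σ, y) : Pt n) ∈ Ptt n :=
  subset_convexHull ℝ _ ⟨matchSet n σ, h.isTournament, fun _ => rfl, hy, hle⟩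

theorem Ptt_subset {C : Set (Pt n)} (hC : Convex ℝ C)
    (h : ∀ σ y, IsSched n σ → (∀ p, travel n (matchSet n σ) p.1 ≤ y p) →
      ((playVec n σ, y) : Pt n) ∈ C) : Ptt n ⊆ C := by
  refine convexHull_min ?_ hC
  rintro ⟨x, y⟩ ⟨T, hT, hx, -, hle⟩
  obtain ⟨σ, hσ, rfl⟩ := hT.exists_sched
  obtain rfl : x = playVec n σ := funext hx
  exact h σ y hσ hle

theorem travel_le_one (T : Set (ℕ × ℕ × ℕ)) (p : ℕ × ℕ × ℕ) : travel n T p ≤ 1 := by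
  unfold travel
  split_ifs <;> norm_num

end Vertices

section Form

/-- The play coordinate as a linear form. -/
noncomputable def xForm (n s a b : ℕ) : Pt n →ₗ[ℝ] ℝ where
  toFun z := xval z s a b
  map_add' z w := by unfold xval; split_ifs <;> simp
  map_smul' c z := by unfold xval; split_ifs <;> simp

/-- The travel coordinate as a linear form. -/
noncomputable def yForm (n t a b : ℕ) : Pt n →ₗ[ℝ] ℝ where
  toFun z := yval z t a b
  map_add' z w := by unfold yval; split_ifs <;> simp
  map_smul' c z := by unfold yval; split_ifs <;> simp

/-- The left-hand side of the lifted away-home inequality. -/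
noncomputable def faceForm (n k i t : ℕ) : Pt n →ₗ[ℝ] ℝ :=
  xForm n (2 * n - 2) i t + xForm n k i t + (∑ j ∈ Finset.Icc 1 n \ {t}, xForm n k t j) +
    xForm n (k - 1) i t - yForm n t i t

theorem faceForm_apply (n k i t : ℕ) (z : Pt n) : faceForm n k i t z =
    xval z (2 * n - 2) i t + xval z k i t + (∑ j ∈ Finset.Icc 1 n \ {t}, xval z k t j)
        + xval z (k - 1) i t - yval z t i t := by
  simp [faceForm, xForm, yForm, LinearMap.sum_apply]

variable {n k i t : ℕ} {σ : ℕ → ℕ → ℕ}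

/-- The play part of the left-hand side of the lifted away-home inequality. -/
noncomputable def playPart (n k i t : ℕ) (σ : ℕ → ℕ → ℕ) : ℝ :=
  (if σ i t = 2 * n - 2 then 1 else 0) + (if σ i t = k then 1 else 0) +
    (if HomeAt n σ t k then 1 else 0) + (if σ i t = k - 1 then 1 else 0)

theorem IsSched.sum_home (h : IsSched n σ) (ht : t ∈ Icc 1 n)
    (y : {p : ℕ × ℕ × ℕ // IsTravelIdx n p} → ℝ) :
    ∑ j ∈ Finset.Icc 1 n \ {t}, xval ((playVec n σ, y) : Pt n) k t j =
      if HomeAt n σ t k then 1 else 0 := by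
  have hmem : ∀ j ∈ Finset.Icc 1 n \ {t}, j ∈ Icc 1 n ∧ t ≠ j := by
    intro j hj
    rw [mem_sdiff, mem_singleton] at hj
    exact ⟨hj.1, Ne.symm hj.2⟩
  rw [Finset.sum_congr rfl fun j hj => h.xval_eq y ht (hmem j hj).1 (hmem j hj).2]
  split_ifs with hh
  · obtain ⟨v, hv, htv, e⟩ := hh
    rw [Finset.sum_eq_single v, if_pos e]
    · intro j hj hjv
      rw [if_neg]
      intro e'
      exact hjv (h.home t ht j (hmem j hj).1 v hv (hmem j hj).2 htv (e'.trans e.symm))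
    · intro hv'
      simp [hv, Ne.symm htv] at hv'
  · refine Finset.sum_eq_zero fun j hj => if_neg fun e => hh ⟨j, (hmem j hj).1, (hmem j hj).2, e⟩

theorem isTravelIdx_of_mem {a b : ℕ} (ht : t ∈ Icc 1 n) (ha : a ∈ Icc 1 n) (hb : b ∈ Icc 1 n)
    (hab : a ≠ b) : IsTravelIdx n (t, a, b) := by
  rw [mem_Icc] at ht ha hb
  exact ⟨ht.1, ht.2, ha.1, ha.2, hb.1, hb.2, hab⟩

theorem IsSched.faceForm_eq (h : IsSched n σ) (hi : i ∈ Icc 1 n) (ht : t ∈ Icc 1 n) (hit : i ≠ t)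
    (y : {p : ℕ × ℕ × ℕ // IsTravelIdx n p} → ℝ) :
    faceForm n k i t (playVec n σ, y) =
      playPart n k i t σ - y ⟨(t, i, t), isTravelIdx_of_mem ht hi ht hit⟩ := by
  rw [faceForm_apply, h.sum_home ht, h.xval_eq y hi ht hit, h.xval_eq y hi ht hit,
    h.xval_eq y hi ht hit, yval, dif_pos (isTravelIdx_of_mem ht hi ht hit), playPart]

theorem IsSched.slot_facts (h : IsSched n σ) (hk : k ∈ Icc 1 (2 * n - 2)) (hk1 : k ≠ 1)
    (hi : i ∈ Icc 1 n) (ht : t ∈ Icc 1 n) (hit : i ≠ t) :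
    (σ i t = 2 * n - 2 → ¬ AwayAt n σ t (σ i t + 1)) ∧ (σ i t = k → ¬ HomeAt n σ t k) ∧
      (σ i t = k - 1 → (HomeAt n σ t k ↔ ¬ AwayAt n σ t (σ i t + 1))) := by
  refine ⟨?_, ?_, ?_⟩
  · rintro e ⟨v, hv, htv, e'⟩
    have := h.mem v hv t ht (Ne.symm htv)
    rw [mem_Icc] at this
    omega
  · rintro rfl ⟨v, hv, htv, e⟩
    exact h.disj t ht v hv i hi htv (Ne.symm hit) e
  · intro e
    rw [show σ i t + 1 = k by rw [mem_Icc] at hk; omega]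
    constructor
    · rintro ⟨v, hv, htv, e1⟩ ⟨u, hu, htu, e2⟩
      exact h.disj t ht v hv u hu htv htu (e1.trans e2.symm)
    · intro hA
      obtain ⟨v, hv, htv, e1 | e1⟩ := h.exists_opponent ht hk
      · exact ⟨v, hv, htv, e1⟩
      · exact absurd ⟨v, hv, htv, e1⟩ hA

theorem IsSched.playPart_le (h : IsSched n σ) (hk : k ∈ Icc 1 (2 * n - 2)) (hk1 : k ≠ 1)
    (hi : i ∈ Icc 1 n) (ht : t ∈ Icc 1 n) (hit : i ≠ t) :
    playPart n k i t σ - 1 ≤ travel n (matchSet n σ) (t, i, t) := by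
  obtain ⟨f1, f2, f3⟩ := h.slot_facts hk hk1 hi ht hit
  rw [mem_Icc] at hk
  rw [h.travel_home hi ht hit, playPart]
  by_cases c3 : σ i t = k - 1
  · rw [if_neg (by omega : ¬ σ i t = 2 * n - 2), if_neg (by omega : ¬ σ i t = k), if_pos c3]
    by_cases c5 : AwayAt n σ t (σ i t + 1)
    · rw [if_pos c5, if_neg fun c => (f3 c3).1 c c5]
      norm_num
    · rw [if_neg c5, if_pos ((f3 c3).2 c5)]
      norm_num
  · rw [if_neg c3]
    by_cases c1 : σ i t = 2 * n - 2
    · rw [if_pos c1, if_neg (f1 c1)]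
      by_cases c2 : σ i t = k
      · rw [if_pos c2, if_neg (f2 c2)]
        norm_num
      · rw [if_neg c2]
        split_ifs <;> norm_num
    · rw [if_neg c1]
      by_cases c2 : σ i t = k
      · rw [if_pos c2, if_neg (f2 c2)]
        split_ifs <;> norm_num
      · rw [if_neg c2]
        split_ifs <;> norm_num

theorem IsTight.playPart_eq (hT : IsTight n k i t σ) (h : IsSched n σ)
    (hk : k ∈ Icc 1 (2 * n - 2)) (hk1 : k ≠ 1)
    (hi : i ∈ Icc 1 n) (ht : t ∈ Icc 1 n) (hit : i ≠ t) :
    (playPart n k i t σ - 1 = 0 ∨ playPart n k i t σ - 1 = 1) ∧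
      travel n (matchSet n σ) (t, i, t) ≤ playPart n k i t σ - 1 := by
  obtain ⟨f1, f2, f3⟩ := h.slot_facts hk hk1 hi ht hit
  rw [mem_Icc] at hk
  rw [h.travel_home hi ht hit, playPart]
  by_cases c3 : σ i t = k - 1
  · rw [if_neg (by omega : ¬ σ i t = 2 * n - 2), if_neg (by omega : ¬ σ i t = k), if_pos c3]
    by_cases c5 : AwayAt n σ t (σ i t + 1)
    · rw [if_pos c5, if_neg fun c => (f3 c3).1 c c5]
      norm_num
    · rw [if_neg c5, if_pos ((f3 c3).2 c5)]
      norm_num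
  · obtain ⟨c2, ha⟩ | ⟨hh, ha⟩ := hT.resolve_left c3
    · rw [if_neg c3, if_pos c2, if_neg (f2 c2)]
      obtain rfl | ha := ha
      · rw [if_pos c2, if_neg (f1 c2)]
        norm_num
      · rw [← c2] at ha
        rw [if_neg fun c => f1 c ha, if_pos ha]
        norm_num
    · rw [if_neg c3, if_neg fun c => f2 c hh, if_pos hh]
      obtain c1 | ha := ha
      · rw [if_pos c1, if_neg (f1 c1)]
        norm_num
      · rw [if_neg fun c => f1 c ha, if_pos ha]
        norm_num

end Form

section Facet

/-- A face is a facet if each linear form that is constant on it is, up to a constant, a multiple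
of the defining form. -/
theorem finrank_direction_face_add_one {E : Type*} [AddCommGroup E] [Module ℝ E]
    [FiniteDimensional ℝ E] (f : E →ₗ[ℝ] ℝ) (c : ℝ) (P : Set E) (hmem : ∃ z ∈ P, f z = c)
    (hnot : ∃ z ∈ P, f z ≠ c)
    (hdual : ∀ φ : E →ₗ[ℝ] ℝ, (∀ z ∈ P, ∀ w ∈ P, f z = c → f w = c → φ z = φ w) →
      ∃ b, ∀ z ∈ P, ∀ w ∈ P, φ z - φ w = b * (f z - f w)) :
    Module.finrank ℝ (affineSpan ℝ {z ∈ P | f z = c}).direction + 1 =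
      Module.finrank ℝ (affineSpan ℝ P).direction := by
  rw [direction_affineSpan, direction_affineSpan]
  set L := vectorSpan ℝ {z ∈ P | f z = c} with hL
  set D := vectorSpan ℝ P with hD
  have hLD : L ≤ D := vectorSpan_mono ℝ fun z hz => hz.1
  have hLf : L ≤ LinearMap.ker f := by
    rw [hL, vectorSpan_def, Submodule.span_le]
    rintro _ ⟨z, hz, w, hw, rfl⟩
    simp [hz.2, hw.2]
  have hDL : D ⊓ LinearMap.ker f ≤ L := by
    rintro v ⟨hv, hfv⟩
    by_contra hvL
    obtain ⟨φ, hφv, hφL⟩ := Submodule.exists_le_ker_of_notMem hvL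
    obtain ⟨b, hb⟩ := hdual φ fun z hz w hw ez ew => by
      have := hφL (vsub_mem_vectorSpan ℝ (s := {z ∈ P | f z = c}) ⟨hz, ez⟩ ⟨hw, ew⟩)
      simpa [sub_eq_zero] using this
    have hDb : D ≤ LinearMap.ker (φ - b • f) := by
      rw [hD, vectorSpan_def, Submodule.span_le]
      rintro _ ⟨z, hz, w, hw, rfl⟩
      have := hb z hz w hw
      simp only [SetLike.mem_coe, LinearMap.mem_ker, vsub_eq_sub, LinearMap.sub_apply,
        LinearMap.smul_apply, map_sub, smul_eq_mul]
      linarith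
    have := hDb hv
    replace hfv : f v = 0 := hfv
    rw [LinearMap.mem_ker, LinearMap.sub_apply, LinearMap.smul_apply, hfv, smul_zero,
      sub_zero] at this
    exact hφv this
  obtain ⟨z, hz, ez⟩ := hmem
  obtain ⟨w, hw, ew⟩ := hnot
  have hg : f.domRestrict D ≠ 0 := fun h0 => ew <| by
    have := LinearMap.congr_fun h0 ⟨w -ᵥ z, vsub_mem_vectorSpan ℝ hw hz⟩
    simp only [LinearMap.domRestrict_apply, vsub_eq_sub, map_sub, ez, LinearMap.zero_apply] at this
    linarith
  have hker : LinearMap.ker (f.domRestrict D) = L.comap D.subtype := by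
    ext ⟨v, hv⟩
    exact ⟨fun h => hDL ⟨hv, h⟩, fun h => hLf h⟩
  rw [← LinearMap.finrank_range_add_finrank_ker (f.domRestrict D), hker,
    (Submodule.comapSubtypeEquivOfLe hLD).finrank_eq,
    LinearMap.range_eq_top.2 (LinearMap.surjective hg), finrank_top, Module.finrank_self, add_comm]

instance (n : ℕ) : Finite {m : ℕ × ℕ × ℕ // IsMatch n m} := by
  refine Set.Finite.subset
    (finite_toSet (range (2 * n) ×ˢ range (n + 1) ×ˢ range (n + 1))) ?_
  rintro ⟨s, a, b⟩ ⟨h₁, h₂, h₃, h₄, h₅, h₆, -⟩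
  dsimp only at h₁ h₂ h₃ h₄ h₅ h₆
  simp only [mem_coe, mem_product, mem_range]
  omega

instance (n : ℕ) : Finite {p : ℕ × ℕ × ℕ // IsTravelIdx n p} := by
  refine Set.Finite.subset
    (finite_toSet (range (n + 1) ×ˢ range (n + 1) ×ˢ range (n + 1))) ?_
  rintro ⟨t, a, b⟩ ⟨h₁, h₂, h₃, h₄, h₅, h₆, -⟩
  dsimp only at h₁ h₂ h₃ h₄ h₅ h₆
  simp only [mem_coe, mem_product, mem_range]
  omega

variable {n k i t : ℕ}

theorem faceForm_le_one (hk : k ∈ Icc 1 (2 * n - 2)) (hk1 : k ≠ 1)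
    (hi : i ∈ Icc 1 n) (ht : t ∈ Icc 1 n) (hit : i ≠ t) :
    ∀ z ∈ Ptt n, faceForm n k i t z ≤ 1 := by
  refine Ptt_subset (C := {z | faceForm n k i t z ≤ 1})
    (convex_halfSpace_le (faceForm n k i t).isLinear 1) fun σ y h hle => ?_
  have h1 := h.playPart_le hk hk1 hi ht hit
  have h2 := hle ⟨(t, i, t), isTravelIdx_of_mem ht hi ht hit⟩
  rw [Set.mem_ofPred_eq, h.faceForm_eq hi ht hit]
  linarith

theorem exists_faceForm_eq_zero (hn : 4 ≤ n) (he : Even n) (hk : k ∈ Icc 1 (2 * n - 2))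
    (hk1 : k ≠ 1) (hi : i ∈ Icc 1 n) (ht : t ∈ Icc 1 n) (hit : i ≠ t) :
    ∃ z ∈ Ptt n, faceForm n k i t z = 0 := by
  have hkm : k - 1 ∈ Icc 1 (2 * n - 2) := by rw [mem_Icc] at hk ⊢; omega
  obtain ⟨r, hr, r1, r2, -⟩ := exists_mem_Icc_ne hn t i i
  obtain ⟨σ, h, hσ⟩ := exists_isSched_of_list hn he ht [((i, false), k - 1), ((r, false), k)]
    (by simpa [Ne.symm hit, Ne.symm r1] using ⟨⟨mem_Icc.1 hi, by simpa using hkm⟩,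
      mem_Icc.1 hr, mem_Icc.1 hk⟩) (by
      rw [mem_Icc] at hk
      simp [Ne.symm r2]
      omega)
  have e1 : σ i t = k - 1 := hσ ((i, false), k - 1) (by simp)
  have e2 : σ r t = k := hσ ((r, false), k) (by simp)
  refine ⟨(playVec n σ, fun _ => 1), h.mem_Ptt (fun _ => Or.inr rfl) fun _ => travel_le_one _ _, ?_⟩
  have hh : ¬ HomeAt n σ t k := by
    rintro ⟨v, hv, htv, e⟩
    exact h.disj t ht v hv r hr htv (Ne.symm r1) (e.trans e2.symm)
  rw [mem_Icc] at hk
  rw [h.faceForm_eq hi ht hit, playPart, if_neg (by omega), if_neg (by omega), if_neg hh, if_pos e1]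
  norm_num

/-- The vertices of the face. -/
theorem IsTight.mem_face {σ : ℕ → ℕ → ℕ} (hT : IsTight n k i t σ) (h : IsSched n σ)
    (hk : k ∈ Icc 1 (2 * n - 2)) (hk1 : k ≠ 1) (hi : i ∈ Icc 1 n) (ht : t ∈ Icc 1 n) (hit : i ≠ t)
    {y : {p : ℕ × ℕ × ℕ // IsTravelIdx n p} → ℝ}
    (h0 : y ⟨(t, i, t), isTravelIdx_of_mem ht hi ht hit⟩ = playPart n k i t σ - 1)
    (hy : ∀ p, p.1 ≠ (t, i, t) → y p = 1 ∨ y p = 0 ∧ travel n (matchSet n σ) p.1 = 0) :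
    ((playVec n σ, y) : Pt n) ∈ Ptt n ∧ faceForm n k i t (playVec n σ, y) = 1 := by
  obtain ⟨h1, h2⟩ := hT.playPart_eq h hk hk1 hi ht hit
  refine ⟨h.mem_Ptt (fun p => ?_) (fun p => ?_), ?_⟩
  · obtain ⟨p, hp⟩ := p
    by_cases e : p = (t, i, t)
    · subst e
      rwa [h0]
    · exact (hy ⟨p, hp⟩ e).elim Or.inr fun h => Or.inl h.1
  · obtain ⟨p, hp⟩ := p
    by_cases e : p = (t, i, t)
    · subst e
      rwa [h0]
    · obtain h' | h' := hy ⟨p, hp⟩ e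
      · rw [h']
        exact travel_le_one _ _
      · rw [h'.1, h'.2]
  · rw [h.faceForm_eq hi ht hit, h0]
    ring

theorem IsTight.exists_mem_face {σ : ℕ → ℕ → ℕ} (hT : IsTight n k i t σ) (h : IsSched n σ)
    (hk : k ∈ Icc 1 (2 * n - 2)) (hk1 : k ≠ 1) (hi : i ∈ Icc 1 n) (ht : t ∈ Icc 1 n)
    (hit : i ≠ t) :
    ∃ y, ((playVec n σ, y) : Pt n) ∈ Ptt n ∧ faceForm n k i t (playVec n σ, y) = 1 :=
  ⟨_, hT.mem_face h hk hk1 hi ht hit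
    (y := Function.update (fun _ => 1) _ (playPart n k i t σ - 1)) (Function.update_self ..)
    fun _ hq => Or.inl <| Function.update_of_ne (fun e => hq (congrArg Subtype.val e)) _ _⟩

theorem exists_isTight (hn : 4 ≤ n) (he : Even n) (hk : k ∈ Icc 1 (2 * n - 2)) (hk1 : k ≠ 1)
    (hi : i ∈ Icc 1 n) (ht : t ∈ Icc 1 n) (hit : i ≠ t) : ∃ σ, IsSched n σ ∧ IsTight n k i t σ := by
  obtain ⟨σ, h1, h2, -⟩ := exists_isTight_travel_eq_zero hn he hk hk1 hi ht hit ht ht hi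
    (Ne.symm hit) (by simp [hit])
  exact ⟨σ, h1, h2⟩

/-- A linear form that is constant on the face and does not involve `y_{t,i,t}` is constant. -/
theorem const_of_const_on_face (hn : 4 ≤ n) (he : Even n) (hk : k ∈ Icc 1 (2 * n - 2))
    (hk1 : k ≠ 1) (hi : i ∈ Icc 1 n) (ht : t ∈ Icc 1 n) (hit : i ≠ t) (φ : Pt n →ₗ[ℝ] ℝ)
    (h0 : φ (0, Pi.single ⟨(t, i, t), isTravelIdx_of_mem ht hi ht hit⟩ 1) = 0)
    (hφ : ∀ z ∈ Ptt n, ∀ w ∈ Ptt n, faceForm n k i t z = 1 → faceForm n k i t w = 1 → φ z = φ w) :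
    ∀ z ∈ Ptt n, ∀ w ∈ Ptt n, φ z = φ w := by
  have hsingle : ∀ p, φ (0, Pi.single p 1) = 0 := by
    rintro ⟨⟨u, a, b⟩, hp⟩
    by_cases e : (u, a, b) = (t, i, t)
    · simpa only [e] using h0
    obtain ⟨σ, h, hT, h3⟩ := exists_isTight_travel_eq_zero (u := u) (a := a) (b := b) hn he hk hk1
      hi ht hit (mem_Icc.2 ⟨hp.1, hp.2.1⟩) (mem_Icc.2 ⟨hp.2.2.1, hp.2.2.2.1⟩)
      (mem_Icc.2 ⟨hp.2.2.2.2.1, hp.2.2.2.2.2.1⟩) hp.2.2.2.2.2.2 e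
    set p : {p : ℕ × ℕ × ℕ // IsTravelIdx n p} := ⟨(u, a, b), hp⟩
    set p₀ : {p : ℕ × ℕ × ℕ // IsTravelIdx n p} :=
      ⟨(t, i, t), isTravelIdx_of_mem ht hi ht hit⟩ with hp₀
    have hne : p₀ ≠ p := fun h => e (congrArg Subtype.val h).symm
    set y : {p : ℕ × ℕ × ℕ // IsTravelIdx n p} → ℝ :=
      Function.update (fun _ => 1) p₀ (playPart n k i t σ - 1) with hy
    have hy1 : ∀ q, q.1 ≠ (t, i, t) → y q = 1 := by
      intro q hq
      rw [hy, Function.update_of_ne]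
      rintro rfl
      exact hq rfl
    have m1 := hT.mem_face h hk hk1 hi ht hit (y := y) (Function.update_self ..)
      fun q hq => Or.inl (hy1 q hq)
    have m2 := hT.mem_face h hk hk1 hi ht hit (y := y - Pi.single p 1)
      (by rw [← hp₀, Pi.sub_apply, Pi.single_eq_of_ne hne, sub_zero, hy, Function.update_self])
      fun q hq => by
        by_cases hqp : q = p
        · subst hqp
          right
          rw [Pi.sub_apply, Pi.single_eq_same, hy1 _ hq]
          exact ⟨sub_self _, h3⟩
        · left
          rw [Pi.sub_apply, Pi.single_eq_of_ne hqp, hy1 _ hq, sub_zero]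
    have := hφ _ m1.1 _ m2.1 m1.2 m2.2
    rw [← sub_eq_zero, ← map_sub, Prod.mk_sub_mk, sub_self, sub_sub_cancel] at this
    exact this
  have hzero : φ ∘ₗ LinearMap.inr ℝ _ _ = 0 := by
    refine LinearMap.pi_ext' fun p => LinearMap.ext_ring ?_
    exact hsingle p
  have hsplit : ∀ x y, φ (x, y) = φ (x, 0) := by
    intro x y
    have := LinearMap.congr_fun hzero y
    rw [LinearMap.comp_apply, LinearMap.inr_apply, LinearMap.zero_apply] at this
    rw [← add_zero (φ (x, 0)), ← this, ← map_add, Prod.mk_add_mk, add_zero, zero_add]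
  have htight : ∀ σ τ, IsSched n σ → IsSched n τ → IsTight n k i t σ → IsTight n k i t τ →
      φ (playVec n σ, 0) = φ (playVec n τ, 0) := by
    intro σ τ hσ hτ sσ sτ
    obtain ⟨y, y1, y2⟩ := sσ.exists_mem_face hσ hk hk1 hi ht hit
    obtain ⟨y', y1', y2'⟩ := sτ.exists_mem_face hτ hk hk1 hi ht hit
    rw [← hsplit _ y, ← hsplit _ y']
    exact hφ _ y1 _ y1' y2 y2'
  have hswap : ∀ σ, IsSched n σ → ∀ j ∈ Icc 1 n, t ≠ j →
      φ (playVec n σ, 0) = φ (playVec n (swapVenues t j σ), 0) := by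
    intro σ h j hj htj
    set d : ℕ → ℝ := fun s => φ (matchVec n s t j - matchVec n s j t, 0) with hd
    have hdiff : ∀ τ, φ (playVec n τ, 0) - φ (playVec n (swapVenues t j τ), 0) =
        d (τ t j) - d (τ j t) := by
      intro τ
      simp only [hd]
      rw [← map_sub, ← map_sub, Prod.mk_sub_mk, Prod.mk_sub_mk, playVec_sub_swapVenues htj, sub_zero]
    have hconst : ∀ a ∈ Icc 1 (2 * n - 2), ∀ b ∈ Icc 1 (2 * n - 2), d a = d b := by
      have hdd : ∀ τ, IsSched n τ → IsTight n k i t τ → IsTight n k i t (swapVenues t j τ) →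
          d (τ t j) = d (τ j t) := fun τ hτ h1 h2 => by
        rw [← sub_eq_zero, ← hdiff, sub_eq_zero]
        exact htight _ _ hτ (hτ.swapVenues t j) h1 h2
      by_cases hji : j = i
      · subst hji
        exact slot_const_self hn he hk hk1 hi ht hit d hdd
      · exact slot_const_of_ne hn he hk hk1 hi ht hit hj htj hji d hdd
    rw [← sub_eq_zero, hdiff, sub_eq_zero]
    exact hconst _ (h.mem t ht j hj htj) _ (h.mem j hj t ht (Ne.symm htj))
  obtain ⟨τ, hτ, sτ⟩ := exists_isTight hn he hk hk1 hi ht hit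
  have hall : ∀ z ∈ Ptt n, φ z = φ (playVec n τ, 0) := by
    refine Ptt_subset (C := {z | φ z = φ (playVec n τ, 0)}) (convex_hyperplane φ.isLinear _)
      fun σ y h _ => ?_
    rw [Set.mem_ofPred_eq, hsplit]
    refine induction_of_tight hk hi ht hit (fun σ => φ (playVec n σ, 0) = φ (playVec n τ, 0)) ?_ ?_ h
    · exact fun σ h j hj htj e => (hswap σ h j hj htj).trans e
    · exact fun σ h hT => htight σ τ h hτ hT sτ
  exact fun z hz w hw => (hall z hz).trans (hall w hw).symm

theorem faceForm_single (hi : i ∈ Icc 1 n) (ht : t ∈ Icc 1 n) (hit : i ≠ t) :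
    faceForm n k i t (0, Pi.single ⟨(t, i, t), isTravelIdx_of_mem ht hi ht hit⟩ 1) = -1 := by
  simp [faceForm_apply, xval, yval, isTravelIdx_of_mem ht hi ht hit]

end Facet

/-- the lifted away-home inequalities are facet-defining. -/
theorem lifted_away_home_facet (n : ℕ) (hn : 4 ≤ n) (heven : Even n)
    (k : ℕ) (hk1 : 1 ≤ k) (hk2 : k ≤ 2 * n - 2) (hk3 : k ≠ 1)
    (i t : ℕ) (hi1 : 1 ≤ i) (hin : i ≤ n) (ht1 : 1 ≤ t) (htn : t ≤ n) (hit : i ≠ t) :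
    IsFacetLE (fun z : Pt n =>
      xval z (2 * n - 2) i t + xval z k i t + (∑ j ∈ Finset.Icc 1 n \ {t}, xval z k t j)
        + xval z (k - 1) i t - yval z t i t) 1 := by
  have hk : k ∈ Icc 1 (2 * n - 2) := mem_Icc.2 ⟨hk1, hk2⟩
  have hi : i ∈ Icc 1 n := mem_Icc.2 ⟨hi1, hin⟩
  have ht : t ∈ Icc 1 n := mem_Icc.2 ⟨ht1, htn⟩
  simp only [← faceForm_apply]
  refine ⟨faceForm_le_one hk hk3 hi ht hit, finrank_direction_face_add_one _ _ _ ?_ ?_ ?_⟩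
  · obtain ⟨σ, h, hT⟩ := exists_isTight hn heven hk hk3 hi ht hit
    obtain ⟨y, hy⟩ := hT.exists_mem_face h hk hk3 hi ht hit
    exact ⟨_, hy⟩
  · obtain ⟨z, hz, e⟩ := exists_faceForm_eq_zero hn heven hk hk3 hi ht hit
    exact ⟨z, hz, by rw [e]; norm_num⟩
  · intro φ hφ
    set b := φ (0, Pi.single ⟨(t, i, t), isTravelIdx_of_mem ht hi ht hit⟩ 1)
    refine ⟨-b, fun z hz w hw => ?_⟩
    have := const_of_const_on_face hn heven hk hk3 hi ht hit (φ + b • faceForm n k i t)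
      (by simp [faceForm_single hi ht hit, b]) (fun z hz w hw ez ew => by
        simp [hφ z hz w hw ez ew, ez, ew]) z hz w hw
    simp only [LinearMap.add_apply, LinearMap.smul_apply, smul_eq_mul] at this
    linarith

end TTP
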